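/- arXiv:2312.17597 — 2 statements merged into one kernel-verified Lean document; each statement's English description precedes it below -/
import Mathlib

section
/- Let S and L be two simple-minded collections of a triangulated category T. If every object of L lies in the extension closure Filt(S) of S, then S = L (up to isomorphism). -/
open CategoryTheory Limits Pretriangulated

namespace STPaper

variable {T : Type*} [Category T] [Preadditive T] [HasZeroObject T]
  [HasShift T ℤ] [∀ n : ℤ, (CategoryTheory.shiftFunctor T n).Additive] [Pretriangulated T]

/-- The shift of a class of objects. -/
def shSet (S : Set T) (n : ℤ) : Set T := (CategoryTheory.shiftFunctor T n).obj '' S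

/-- The class `Y₁ ∗ Y₂`: objects `Z` fitting in a distinguished triangle
`Y₁ → Z → Y₂ → ΣY₁` with `Y₁ ∈ 𝒴₁` and `Y₂ ∈ 𝒴₂`. -/
def star (Y₁ Y₂ : Set T) : Set T :=
  {Z | ∃ (A B : T) (f : A ⟶ Z) (g : Z ⟶ B) (h : B ⟶ A⟦(1:ℤ)⟧),
    (Triangle.mk f g h ∈ distTriang T) ∧ A ∈ Y₁ ∧ B ∈ Y₂}

/-- The extension closure of a class of objects. -/
inductive filt (S : Set T) : T → Prop
  | of {X : T} (h : X ∈ S) : filt S X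
  | zero {X : T} (h : IsZero X) : filt S X
  | ext {A Z B : T} (f : A ⟶ Z) (g : Z ⟶ B) (h : B ⟶ A⟦(1:ℤ)⟧)
      (hT : Triangle.mk f g h ∈ distTriang T) (hA : filt S A) (hB : filt S B) : filt S Z

/-- The thick subcategory generated by a class of objects. -/
inductive thick (S : Set T) : T → Prop
  | of {X : T} (h : X ∈ S) : thick S X
  | zero {X : T} (h : IsZero X) : thick S X
  | shift {X : T} (hX : thick S X) (n : ℤ) : thick S (X⟦n⟧)
  | ext {A Z B : T} (f : A ⟶ Z) (g : Z ⟶ B) (h : B ⟶ A⟦(1:ℤ)⟧)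
      (hT : Triangle.mk f g h ∈ distTriang T) (hA : thick S A) (hB : thick S B) : thick S Z
  | smd {X Y : T} (i : X ⟶ Y) (r : Y ⟶ X) (hir : i ≫ r = 𝟙 X) (hY : thick S Y) : thick S X

/-- Two classes of objects coincide up to isomorphism. -/
def isoEq (S L : Set T) : Prop :=
  (∀ X ∈ S, ∃ Y ∈ L, Nonempty (X ≅ Y)) ∧ (∀ Y ∈ L, ∃ X ∈ S, Nonempty (X ≅ Y))

/-- A simple-minded collection. -/
structure IsSMC (S : Set T) : Prop where
  negVanish : ∀ X ∈ S, ∀ Y ∈ S, ∀ n : ℤ, n < 0 → ∀ f : X ⟶ Y⟦n⟧, f = 0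
  nonzero : ∀ X ∈ S, ¬ IsZero X
  endo : ∀ X ∈ S, ∀ f : X ⟶ X, f = 0 ∨ IsIso f
  noHom : ∀ X ∈ S, ∀ Y ∈ S, X ≠ Y → ∀ f : X ⟶ Y, f = 0
  generates : ∀ X : T, thick S X

/-- `T^{𝒮,≤0}` for a collection `S`. -/
def leS (S : Set T) : Set T :=
  {X | ∀ n : ℤ, 0 < n → ∀ Y ∈ S, ∀ f : X⟦n⟧ ⟶ Y, f = 0}

/-- `Σ^{0}Filt(S) ∗ Σ^{-1}Filt(S) ∗ ⋯ ∗ Σ^{-l}Filt(S)`. -/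
def geChainS (S : Set T) : ℕ → Set T
  | 0 => {X | filt S X}
  | (l+1) => star (geChainS S l) (shSet {X | filt S X} (-(l+1 : ℤ)))

/-- `T^{𝒮,≥0}`. -/
def geS (S : Set T) : Set T := ⋃ l, geChainS S l

/-- `Σ^{l}Filt(S) ∗ Σ^{l-1}Filt(S) ∗ ⋯ ∗ Filt(S)`. -/
def leChainS (S : Set T) : ℕ → Set T
  | 0 => {X | filt S X}
  | (l+1) => star (shSet {X | filt S X} (l+1 : ℤ)) (leChainS S l)

/-- A `t`-structure `(Le, Ge) = (T^{≤0}, T^{≥0})` on `T`. -/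
structure IsTStr (Le Ge : Set T) : Prop where
  le_shift : ∀ X ∈ Le, X⟦(1:ℤ)⟧ ∈ Le
  ge_shift : ∀ X ∈ Ge, X⟦(-1:ℤ)⟧ ∈ Ge
  hom_zero : ∀ X ∈ Le, ∀ Y ∈ Ge, ∀ f : X ⟶ Y⟦(-1:ℤ)⟧, f = 0
  exhaust : ∀ Z : T, Z ∈ star Le (shSet Ge (-1))

/-- The heart of a pair of classes. -/
def heart (Le Ge : Set T) : Set T := Le ∩ Ge

/-- A bounded `t`-structure. -/
structure IsBoundedTStr (Le Ge : Set T) : Prop where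
  toIsTStr : IsTStr Le Ge
  bddRight : ∀ X : T, ∃ n : ℤ, X⟦n⟧ ∈ Le
  bddLeft : ∀ X : T, ∃ n : ℤ, X⟦n⟧ ∈ Ge

/-- A simple object of the heart `H`: a nonzero object such that in any distinguished
triangle `A → X → B → ΣA` with `A, B ∈ H`, one of `A`, `B` vanishes. -/
def heartSimple (H : Set T) (X : T) : Prop :=
  X ∈ H ∧ ¬ IsZero X ∧ ∀ (A B : T) (f : A ⟶ X) (g : X ⟶ B) (h : B ⟶ A⟦(1:ℤ)⟧),
    (Triangle.mk f g h ∈ distTriang T) → A ∈ H → B ∈ H → IsZero A ∨ IsZero B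

/-- An algebraic `t`-structure: a bounded `t`-structure whose heart is a length category,
i.e. every object of the heart is a finite iterated extension of simple objects of the heart. -/
def IsAlgTStr (Le Ge : Set T) : Prop :=
  IsBoundedTStr Le Ge ∧ ∀ X ∈ heart Le Ge, filt {Y | heartSimple (heart Le Ge) Y} X


section Helpers

set_option linter.unusedSectionVars false

open scoped ZeroObject

attribute [-instance] CategoryTheory.catToReflQuiver

/-- All maps vanish. -/
def Hz (X Y : T) : Prop := ∀ f : X ⟶ Y, f = 0

/-- Objects isomorphic to `Y⟦n⟧` with `Y ∈ L`. -/
def Cell (L : Set T) (n : ℤ) (B : T) : Prop := ∃ Y ∈ L, Nonempty (B ≅ Y⟦n⟧)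

/-- Objects built by attaching finitely many cells of degree at most zero. -/
inductive Gd (L : Set T) : T → Prop
  | zero {X : T} (h : IsZero X) : Gd L X
  | ext (t : Triangle T) (ht : t ∈ distTriang T) (h₁ : Gd L t.obj₁) (n : ℤ) (hn : n ≤ 0)
      (h₃ : Cell L n t.obj₃) : Gd L t.obj₂

lemma Hz.of_iso {X Y X' Y' : T} (h : Hz X Y) (e : X' ≅ X) (e' : Y' ≅ Y) : Hz X' Y' := by
  intro f
  have := h (e.inv ≫ f ≫ e'.hom)
  have h2 : f = e.hom ≫ (e.inv ≫ f ≫ e'.hom) ≫ e'.inv := by simp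
  rw [h2, this]; simp

lemma Hz.shift {X Y : T} (h : Hz X Y) (m : ℤ) : Hz (X⟦m⟧) (Y⟦m⟧) := by
  intro f
  obtain ⟨g, rfl⟩ := (shiftFunctor T m).map_surjective f
  rw [h g]; simp

lemma Hz.ext_right {W : T} (t : Triangle T) (ht : t ∈ distTriang T)
    (h₁ : Hz W t.obj₁) (h₃ : Hz W t.obj₃) : Hz W t.obj₂ := by
  intro f
  obtain ⟨g, hg⟩ := t.coyoneda_exact₂ ht f (h₃ _)
  rw [hg, h₁ g]; simp

lemma Hz.ext_left {W : T} (t : Triangle T) (ht : t ∈ distTriang T)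
    (h₁ : Hz t.obj₁ W) (h₃ : Hz t.obj₃ W) : Hz t.obj₂ W := by
  intro f
  obtain ⟨g, hg⟩ := t.yoneda_exact₂ ht f (h₁ _)
  rw [hg, h₃ g]; simp

lemma Hz.of_zero_right {W X : T} (h : IsZero X) : Hz W X := fun f => h.eq_of_tgt f 0
lemma Hz.of_zero_left {W X : T} (h : IsZero X) : Hz X W := fun f => h.eq_of_src f 0

lemma Cell.shift {L : Set T} {n : ℤ} {B : T} (h : Cell L n B) (m k : ℤ) (hk : n + m = k) :
    Cell L k (B⟦m⟧) := by
  obtain ⟨Y, hY, ⟨e⟩⟩ := h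
  exact ⟨Y, hY, ⟨(shiftFunctor T m).mapIso e ≪≫ ((shiftFunctorAdd' T n m k hk).app Y).symm⟩⟩

lemma Cell.of_mem {L : Set T} {Y : T} (h : Y ∈ L) : Cell L 0 Y :=
  ⟨Y, h, ⟨((shiftFunctorZero T ℤ).app Y).symm⟩⟩

lemma Cell.hz {L : Set T} (hL : IsSMC L) {m n : ℤ} (hmn : n < m) {A B : T}
    (hA : Cell L m A) (hB : Cell L n B) : Hz A B := by
  obtain ⟨Y, hY, ⟨e⟩⟩ := hA
  obtain ⟨Y', hY', ⟨e'⟩⟩ := hB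
  have h : Hz Y (Y'⟦n - m⟧) := fun f => hL.negVanish Y hY Y' hY' (n - m) (by omega) f
  exact (h.shift m).of_iso e (e' ≪≫ (shiftFunctorAdd' T (n - m) m n (by omega)).app Y')

lemma Cell.zero_or_iso {L : Set T} (hL : IsSMC L) {n : ℤ} {A B : T}
    (hA : Cell L n A) (hB : Cell L n B) (f : A ⟶ B) : f = 0 ∨ IsIso f := by
  obtain ⟨Y, hY, ⟨e⟩⟩ := hA
  obtain ⟨Y', hY', ⟨e'⟩⟩ := hB
  obtain ⟨g, hg⟩ := (shiftFunctor T n).map_surjective (e.inv ≫ f ≫ e'.hom)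
  have h2 : f = e.hom ≫ (shiftFunctor T n).map g ≫ e'.inv := by rw [hg]; simp
  by_cases hYY : Y = Y'
  · subst hYY
    rcases hL.endo Y hY g with h | h
    · left; rw [h2, h]; simp
    · right; rw [h2]; infer_instance
  · left; rw [h2, hL.noHom Y hY Y' hY' hYY g]; simp

/-- The coaisle-type condition. -/
def Vc (L : Set T) (W : T) : Prop := ∀ n : ℤ, 0 < n → ∀ C, Cell L n C → Hz C W

/-- The aisle-type condition. -/
def Uc (L : Set T) (U : T) : Prop := ∀ n : ℤ, n ≤ 0 → ∀ C, Cell L n C → Hz U C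

lemma Gd.vc {L : Set T} (hL : IsSMC L) {V : T} (h : Gd L V) : Vc L V := by
  induction h with
  | zero h => intro n hn C hC; exact Hz.of_zero_right h
  | ext t ht h₁ n hn h₃ ih =>
    intro m hm C hC
    exact Hz.ext_right t ht (ih m hm C hC) (hC.hz hL (by omega) h₃)

lemma Gd.uc {L : Set T} {U V : T} (hU : Uc L U) (h : Gd L V) : Hz U V := by
  induction h with
  | zero h => exact Hz.of_zero_right h
  | ext t ht h₁ n hn h₃ ih => exact Hz.ext_right t ht ih (hU n hn _ h₃)

lemma Gd.of_cell {L : Set T} {B : T} (n : ℤ) (hn : n ≤ 0) (h : Cell L n B) : Gd L B :=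
  Gd.ext (Triangle.mk (0 : (0 : T) ⟶ B) (𝟙 B) 0) (contractible_distinguished₁ B)
    (Gd.zero (isZero_zero T)) n hn h

lemma exists_ext (t : Triangle T) (ht : t ∈ distTriang T) {W : T} (k : t.obj₁ ⟶ W)
    (hk : t.mor₃ ≫ k⟦(1 : ℤ)⟧' = 0) : ∃ k' : t.obj₂ ⟶ W, t.mor₁ ≫ k' = k := by
  obtain ⟨b, hb, _⟩ := complete_distinguished_triangle_morphism₂ t (contractibleTriangle W) ht
    (contractible_distinguished W) k 0 (hk.trans zero_comp.symm)
  exact ⟨b, hb.trans (Category.comp_id k)⟩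

lemma exact_shift (t : Triangle T) (ht : t ∈ distTriang T) {Z : T} (g : Z ⟶ t.obj₂⟦(1 : ℤ)⟧)
    (hg : g ≫ t.mor₂⟦(1 : ℤ)⟧' = 0) :
    ∃ g' : Z ⟶ t.obj₁⟦(1 : ℤ)⟧, g = g' ≫ t.mor₁⟦(1 : ℤ)⟧' := by
  obtain ⟨k, hk⟩ := t.rotate.coyoneda_exact₁ (rot_of_distTriang _ ht) g hg
  have hk' : g = (show Z ⟶ t.obj₁⟦(1 : ℤ)⟧ from k) ≫ (-t.mor₁⟦(1 : ℤ)⟧') := hk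
  exact ⟨-(show Z ⟶ t.obj₁⟦(1 : ℤ)⟧ from k), by
    rw [Preadditive.neg_comp, ← Preadditive.comp_neg]; exact hk'⟩

/-- Weak pushouts. -/
lemma exists_pushout (t : Triangle T) (ht : t ∈ distTriang T) {V W : T} (a : t.obj₁ ⟶ V)
    (k : V ⟶ W) (φ : t.obj₂ ⟶ W) (h : t.mor₁ ≫ φ = a ≫ k) :
    ∃ (E : T) (j : V ⟶ E) (q : E ⟶ t.obj₃) (u : t.obj₂ ⟶ E) (e : E ⟶ W),
      Triangle.mk j q (t.mor₃ ≫ a⟦(1 : ℤ)⟧') ∈ distTriang T ∧ t.mor₁ ≫ u = a ≫ j ∧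
      j ≫ e = k ∧ u ≫ e = φ := by
  obtain ⟨E, j, q, hE⟩ := distinguished_cocone_triangle₂ (t.mor₃ ≫ a⟦(1 : ℤ)⟧')
  obtain ⟨u, hu₁, hu₂⟩ := complete_distinguished_triangle_morphism₂ t _ ht hE a (𝟙 _)
    (Category.id_comp _).symm
  have hz : (t.mor₃ ≫ a⟦(1 : ℤ)⟧') ≫ k⟦(1 : ℤ)⟧' = 0 := by
    rw [Category.assoc, ← Functor.map_comp, ← h, Functor.map_comp,
      comp_distTriang_mor_zero₃₁_assoc _ ht, zero_comp]
  obtain ⟨e, he⟩ := exists_ext _ hE k hz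
  change E ⟶ W at e
  change t.obj₂ ⟶ E at u
  change t.mor₁ ≫ u = a ≫ j at hu₁
  change t.mor₂ ≫ 𝟙 _ = u ≫ q at hu₂
  change j ≫ e = k at he
  obtain ⟨d, hd⟩ := t.yoneda_exact₂ ht (φ - u ≫ e) (by
    rw [Preadditive.comp_sub, h, reassoc_of% hu₁, he, sub_self])
  have hjq : j ≫ q = 0 := comp_distTriang_mor_zero₁₂ _ hE
  refine ⟨E, j, q, u, e + q ≫ d, hE, hu₁, ?_, ?_⟩
  · rw [Preadditive.comp_add, he, reassoc_of% hjq, zero_comp, add_zero]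
  · rw [Preadditive.comp_add, ← Category.assoc, ← hu₂, Category.comp_id, ← hd]
    abel

lemma Gd.join {L : Set T} {V V₂ W : T} (hV : Gd L V) (hV₂ : Gd L V₂) (b : V ⟶ W) (d : V₂ ⟶ W) :
    ∃ E, Gd L E ∧ ∃ (i : V ⟶ E) (i₂ : V₂ ⟶ E) (e : E ⟶ W), i ≫ e = b ∧ i₂ ≫ e = d := by
  induction hV₂ with
  | zero h => exact ⟨V, hV, 𝟙 _, 0, b, by simp, by simpa using (h.eq_of_src d 0).symm⟩
  | ext t ht h₁ n hn h₃ ih =>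
    obtain ⟨E, hE, i, i₂, e, hi, hi₂⟩ := ih (t.mor₁ ≫ d)
    obtain ⟨E', j, q, u, e', hE', h1, h2, h3⟩ := exists_pushout t ht i₂ e d hi₂.symm
    exact ⟨E', Gd.ext _ hE' hE n hn h₃, i ≫ j, u, e', by rw [Category.assoc, h2, hi], h3⟩

/-- Killing a cell of degree one. -/
lemma Gd.kill {L : Set T} (hL : IsSMC L) {V W Z : T} (hV : Gd L V) (hZ : Cell L 1 Z)
    (g : Z ⟶ V⟦(1 : ℤ)⟧) (f : V ⟶ W) (hgf : g ≫ f⟦(1 : ℤ)⟧' = 0) :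
    ∃ V', Gd L V' ∧ ∃ (a : V ⟶ V') (b : V' ⟶ W), f = a ≫ b ∧ g ≫ a⟦(1 : ℤ)⟧' = 0 := by
  induction hV with
  | @zero X h =>
    exact ⟨X, Gd.zero h, 𝟙 _, f, by simp, by rw [h.eq_of_src (𝟙 X) 0]; simp⟩
  | ext t ht h₁ n hn h₃ ih =>
    have key : g ≫ t.mor₂⟦(1 : ℤ)⟧' = 0 ∨ IsIso (g ≫ t.mor₂⟦(1 : ℤ)⟧') := by
      rcases hn.lt_or_eq with hn | rfl
      · left
        exact hZ.hz hL (by omega) (h₃.shift 1 (n + 1) rfl) _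
      · exact hZ.zero_or_iso hL (h₃.shift 1 1 (by omega)) _
    rcases key with key | key
    · obtain ⟨g₁, hg₁⟩ := exact_shift t ht g key
      obtain ⟨V', hV', a, b, hab, hga⟩ := ih g₁ (t.mor₁ ≫ f) (by
        rw [Functor.map_comp, ← Category.assoc, ← hg₁, hgf])
      obtain ⟨E, j, q, u, e, hE, h1, h2, h3⟩ := exists_pushout t ht a b f hab
      refine ⟨E, Gd.ext _ hE hV' n hn h₃, u, e, h3.symm, ?_⟩
      rw [hg₁, Category.assoc, ← Functor.map_comp, h1, Functor.map_comp, reassoc_of% hga,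
        zero_comp]
    · obtain ⟨s, hs⟩ := (shiftFunctor T (1 : ℤ)).map_surjective
        (inv (g ≫ t.mor₂⟦(1 : ℤ)⟧') ≫ g)
      have hsq : s ≫ t.mor₂ = 𝟙 _ := by
        apply (shiftFunctor T (1 : ℤ)).map_injective
        rw [Functor.map_comp, hs, CategoryTheory.Functor.map_id, Category.assoc, IsIso.inv_hom_id]
      have hsf : s ≫ f = 0 := by
        apply (shiftFunctor T (1 : ℤ)).map_injective
        rw [Functor.map_comp, hs, Category.assoc, hgf]; simp
      have h3 : t.mor₃ = 0 := by
        rw [← Category.id_comp t.mor₃, ← hsq, Category.assoc, comp_distTriang_mor_zero₂₃ _ ht,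
          comp_zero]
      have hmono : Mono t.mor₁ := t.mono₁ ht h3
      obtain ⟨r, hr⟩ := t.coyoneda_exact₂ ht (𝟙 _ - t.mor₂ ≫ s) (by
        rw [Preadditive.sub_comp, Category.assoc, hsq]; simp)
      refine ⟨_, h₁, r, t.mor₁ ≫ f, ?_, ?_⟩
      · rw [← Category.assoc, ← hr, Preadditive.sub_comp, Category.assoc, hsf]; simp
      · rw [← cancel_mono (t.mor₁⟦(1 : ℤ)⟧'), Category.assoc, ← Functor.map_comp, ← hr,
          Functor.map_sub, Functor.map_comp, hs, Preadditive.comp_sub]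
        have := IsIso.hom_inv_id_assoc (g ≫ t.mor₂⟦(1 : ℤ)⟧') g
        rw [Category.assoc] at this
        rw [this]; simp

/-- Maps to `W` factor through good objects. -/
def Pc (L : Set T) (W Z : T) : Prop :=
  ∀ f : Z ⟶ W, ∃ V, Gd L V ∧ ∃ (a : Z ⟶ V) (b : V ⟶ W), f = a ≫ b

/-- Maps from `Z` can be killed over `W`. -/
def Qc (L : Set T) (W Z : T) : Prop :=
  ∀ V, Gd L V → ∀ (g : Z ⟶ V⟦(1 : ℤ)⟧) (f : V ⟶ W), g ≫ f⟦(1 : ℤ)⟧' = 0 →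
    ∃ V', Gd L V' ∧ ∃ (a : V ⟶ V') (b : V' ⟶ W), f = a ≫ b ∧ g ≫ a⟦(1 : ℤ)⟧' = 0

lemma Pc.retract {L : Set T} {W X Y : T} (i : X ⟶ Y) (r : Y ⟶ X) (h : i ≫ r = 𝟙 X)
    (hY : Pc L W Y) : Pc L W X := by
  intro f
  obtain ⟨V, hV, a, b, hab⟩ := hY (r ≫ f)
  exact ⟨V, hV, i ≫ a, b, by rw [Category.assoc, ← hab, reassoc_of% h]⟩

lemma Qc.retract {L : Set T} {W X Y : T} (i : X ⟶ Y) (r : Y ⟶ X) (h : i ≫ r = 𝟙 X)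
    (hY : Qc L W Y) : Qc L W X := by
  intro V hV g f hgf
  obtain ⟨V', hV', a, b, hab, hga⟩ := hY V hV (r ≫ g) f (by rw [Category.assoc, hgf, comp_zero])
  refine ⟨V', hV', a, b, hab, ?_⟩
  have := congrArg (fun x => i ≫ x) hga
  simpa [reassoc_of% h] using this

lemma Pc.cell {L : Set T} {W : T} (hW : Vc L W) {n : ℤ} {Z : T} (hZ : Cell L n Z) :
    Pc L W Z := by
  intro f
  by_cases hn : n ≤ 0
  · exact ⟨Z, Gd.of_cell n hn hZ, 𝟙 _, f, by simp⟩
  · exact ⟨0, Gd.zero (isZero_zero T), 0, 0, by rw [hW n (by omega) Z hZ f]; simp⟩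

lemma Qc.cell {L : Set T} (hL : IsSMC L) {W : T} {n : ℤ} {Z : T} (hZ : Cell L n Z) :
    Qc L W Z := by
  intro V hV g f hgf
  by_cases hn : n ≤ 0
  · obtain ⟨E, j, q, hE⟩ := distinguished_cocone_triangle₂ g
    obtain ⟨e, he⟩ := exists_ext _ hE f hgf
    exact ⟨E, Gd.ext _ hE hV n hn hZ, j, e, he.symm, comp_distTriang_mor_zero₃₁ _ hE⟩
  · rcases eq_or_ne n 1 with rfl | hn1
    · exact hV.kill hL hZ g f hgf
    · have h0 : g = 0 := by
        have := ((hV.vc hL) (n - 1) (by omega) _ (hZ.shift (-1) (n - 1) (by omega))).shift 1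
        exact this.of_iso ((shiftFunctorCompIsoId T (-1 : ℤ) 1 (by omega)).app Z).symm
          (Iso.refl _) g
      exact ⟨V, hV, 𝟙 _, f, by simp, by rw [h0]; simp⟩

lemma Pc.ext {L : Set T} {W : T} (t : Triangle T) (ht : t ∈ distTriang T)
    (hP₁ : Pc L W t.obj₁) (hP₃ : Pc L W t.obj₃) (hQ₃ : Qc L W t.obj₃) : Pc L W t.obj₂ := by
  intro f
  obtain ⟨V, hV, a, b, hab⟩ := hP₁ (t.mor₁ ≫ f)
  obtain ⟨V', hV', a', b', hab', hg⟩ := hQ₃ V hV (t.mor₃ ≫ a⟦(1 : ℤ)⟧') b (by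
    rw [Category.assoc, ← Functor.map_comp, ← hab, Functor.map_comp,
      comp_distTriang_mor_zero₃₁_assoc _ ht, zero_comp])
  obtain ⟨k, hk⟩ := exists_ext t ht (a ≫ a') (by
    rw [Functor.map_comp, ← Category.assoc, hg])
  obtain ⟨d, hd⟩ := t.yoneda_exact₂ ht (f - k ≫ b') (by
    rw [Preadditive.comp_sub, reassoc_of% hk, hab, ← hab', sub_self])
  obtain ⟨V₂, hV₂, c, e, hce⟩ := hP₃ d
  obtain ⟨E, hE, i, i₂, w, hi, hi₂⟩ := hV'.join hV₂ b' e
  refine ⟨E, hE, k ≫ i + t.mor₂ ≫ c ≫ i₂, w, ?_⟩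
  simp only [Preadditive.add_comp, Category.assoc, hi, hi₂, ← hce, ← hd]
  abel

lemma Qc.ext {L : Set T} {W : T} (t : Triangle T) (ht : t ∈ distTriang T)
    (hP₁ : Pc L W t.obj₁) (hQ₁ : Qc L W t.obj₁) (hQ₃ : Qc L W t.obj₃) : Qc L W t.obj₂ := by
  intro V hV g f hgf
  obtain ⟨V', hV', a, b, hab, hga⟩ := hQ₁ V hV (t.mor₁ ≫ g) f (by
    rw [Category.assoc, hgf, comp_zero])
  obtain ⟨g₂, hg₂⟩ := t.yoneda_exact₂ ht (g ≫ a⟦(1 : ℤ)⟧') (by rw [← Category.assoc, hga])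
  obtain ⟨k, hk⟩ := t.yoneda_exact₃ ht (g₂ ≫ b⟦(1 : ℤ)⟧') (by
    rw [← Category.assoc, ← hg₂, Category.assoc, ← Functor.map_comp, ← hab, hgf])
  obtain ⟨k, rfl⟩ := (shiftFunctor T (1 : ℤ)).map_surjective k
  obtain ⟨V₂, hV₂, c, d, hcd⟩ := hP₁ k
  obtain ⟨E, hE, i, i₂, w, hi, hi₂⟩ := hV'.join hV₂ b d
  obtain ⟨V₃, hV₃, a₃, b₃, hab₃, hga₃⟩ := hQ₃ E hE
    (g₂ ≫ i⟦(1 : ℤ)⟧' - t.mor₃ ≫ (c ≫ i₂)⟦(1 : ℤ)⟧') w (by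
      rw [Preadditive.sub_comp, Category.assoc, Category.assoc, ← Functor.map_comp,
        ← Functor.map_comp, Category.assoc, hi, hi₂, ← hcd, hk, sub_self])
  refine ⟨V₃, hV₃, a ≫ i ≫ a₃, b₃, ?_, ?_⟩
  · rw [Category.assoc, Category.assoc, ← hab₃, hi, hab]
  · have h1 : t.mor₂ ≫ (g₂ ≫ i⟦(1 : ℤ)⟧' - t.mor₃ ≫ (c ≫ i₂)⟦(1 : ℤ)⟧') =
        t.mor₂ ≫ g₂ ≫ i⟦(1 : ℤ)⟧' := by
      rw [Preadditive.comp_sub, comp_distTriang_mor_zero₂₃_assoc _ ht, zero_comp, sub_zero]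
    have h2 := congrArg (fun x => t.mor₂ ≫ x) hga₃
    change t.mor₂ ≫ (_ ≫ _) = t.mor₂ ≫ 0 at h2
    rw [← Category.assoc, h1, comp_zero] at h2
    rw [Functor.map_comp, Functor.map_comp, ← Category.assoc, hg₂]
    simpa using h2

lemma PQ_of_thick {L : Set T} (hL : IsSMC L) {W : T} (hW : Vc L W) {Z : T} (hZ : thick L Z) :
    ∀ n : ℤ, Pc L W (Z⟦n⟧) ∧ Qc L W (Z⟦n⟧) := by
  induction hZ with
  | of h =>
    intro n
    have := (Cell.of_mem h).shift n n (by omega)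
    exact ⟨Pc.cell hW this, Qc.cell hL this⟩
  | @zero X h =>
    intro n
    have h0 : IsZero (X⟦n⟧) := (shiftFunctor T n).map_isZero h
    refine ⟨fun f => ⟨0, Gd.zero (isZero_zero T), 0, 0, h0.eq_of_src _ _⟩, ?_⟩
    intro V hV g f _
    exact ⟨V, hV, 𝟙 _, f, by simp, h0.eq_of_src _ _⟩
  | @shift X hX m ih =>
    intro n
    let e := (shiftFunctorAdd' T m n (m + n) rfl).app X
    exact ⟨Pc.retract e.inv e.hom e.inv_hom_id (ih (m + n)).1,
      Qc.retract e.inv e.hom e.inv_hom_id (ih (m + n)).2⟩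
  | ext f g h hT hA hB ihA ihB =>
    intro n
    have ht := Triangle.shift_distinguished _ hT n
    exact ⟨Pc.ext _ ht (ihA n).1 (ihB n).1 (ihB n).2, Qc.ext _ ht (ihA n).1 (ihA n).2 (ihB n).2⟩
  | smd i r hir hY ih =>
    intro n
    have h : i⟦n⟧' ≫ r⟦n⟧' = 𝟙 _ := by rw [← Functor.map_comp, hir, CategoryTheory.Functor.map_id]
    exact ⟨Pc.retract _ _ h (ih n).1, Qc.retract _ _ h (ih n).2⟩

lemma isZero_of_uc_vc {L : Set T} (hL : IsSMC L) {X : T} (hU : Uc L X) (hV : Vc L X) :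
    IsZero X := by
  have hP : Pc L X X := by
    let e := (shiftFunctorZero T ℤ).app X
    exact Pc.retract e.inv e.hom e.inv_hom_id (PQ_of_thick hL hV (hL.generates X) 0).1
  obtain ⟨V, hVG, a, b, hab⟩ := hP (𝟙 X)
  rw [hVG.uc hU a, zero_comp] at hab
  exact (IsZero.iff_id_eq_zero X).2 hab

lemma filt_neg {S : Set T} (hS : IsSMC S) {A B : T} (hA : filt S A) (hB : filt S B) {n : ℤ}
    (hn : n < 0) : Hz A (B⟦n⟧) := by
  induction hA with
  | @of X hX =>
    induction hB with
    | @of Y hY => exact fun f => hS.negVanish X hX Y hY n hn f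
    | zero h => exact Hz.of_zero_right ((shiftFunctor T n).map_isZero h)
    | ext f g h hT hA hB ihA ihB =>
      exact Hz.ext_right _ (Triangle.shift_distinguished _ hT n) ihA ihB
  | zero h => exact Hz.of_zero_left h
  | ext f g h hT hA hB ihA ihB => exact Hz.ext_left _ hT ihA ihB

lemma filt_neg' {S : Set T} (hS : IsSMC S) {A B : T} (hA : filt S A) (hB : filt S B) {m n : ℤ}
    (hn : n < m) : Hz (A⟦m⟧) (B⟦n⟧) :=
  ((filt_neg hS hA hB (n := n - m) (by omega)).shift m).of_iso (Iso.refl _)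
    ((shiftFunctorAdd' T (n - m) m n (by omega)).app B)

lemma filt_comp_ne {S : Set T} (hS : IsSMC S) {A X B : T} (hA : filt S A) (hX : X ∈ S)
    (hB : filt S B) (ψ : A ⟶ X) (hψ : ψ ≠ 0) (φ : X ⟶ B) (h : ψ ≫ φ = 0) : φ = 0 := by
  induction hB with
  | @of Y hY =>
    by_cases hXY : X = Y
    · subst hXY
      rcases hS.endo X hX φ with h0 | h0
      · exact h0
      · exact absurd ((cancel_mono φ).1 (by rw [h, zero_comp])) hψ
    · exact hS.noHom X hX Y hY hXY φ
  | zero h0 => exact h0.eq_of_tgt _ _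
  | @ext B₁ B B₂ f g k hT h₁ h₂ ih₁ ih₂ =>
    have h0 : φ ≫ g = 0 := ih₂ _ (by rw [← Category.assoc, h, zero_comp])
    obtain ⟨φ₁, hφ₁⟩ := Triangle.coyoneda_exact₂ _ hT φ h0
    change X ⟶ B₁ at φ₁
    change φ = φ₁ ≫ f at hφ₁
    have h1 : ψ ≫ φ₁ = 0 := by
      obtain ⟨d, hd⟩ := Triangle.coyoneda_exact₂ _ (inv_rot_of_distTriang _ hT) (ψ ≫ φ₁)
        (show (ψ ≫ φ₁) ≫ f = 0 by rw [Category.assoc, ← hφ₁, h])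
      have : d = 0 := filt_neg hS hA h₂ (n := -1) (by omega) d
      subst this
      exact hd.trans zero_comp
    rw [hφ₁, ih₁ φ₁ h1, zero_comp]

lemma filt_vc {S L : Set T} (hS : IsSMC S) (h : ∀ X ∈ L, filt S X) {A : T} (hA : filt S A) :
    Vc L A := by
  rintro n hn C ⟨Y, hY, ⟨e⟩⟩
  exact (filt_neg' hS (h Y hY) hA hn).of_iso e ((shiftFunctorZero T ℤ).app A).symm

lemma isIso_of_ne_zero {S L : Set T} (hS : IsSMC S) (hL : IsSMC L)
    (h : ∀ X ∈ L, filt S X) {X Y : T} (hX : X ∈ S) (hY : Y ∈ L) (φ : X ⟶ Y) (hφ : φ ≠ 0) :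
    IsIso φ := by
  obtain ⟨C, q, δ, hT⟩ := distinguished_cocone_triangle φ
  have hV : Vc L C := by
    rintro n hn D ⟨Y', hY', ⟨e⟩⟩
    refine Hz.of_iso (X := Y'⟦n⟧) ?_ e (Iso.refl C)
    intro f
    have hY0 : Hz (Y'⟦n⟧) Y := filt_vc hS h (h Y hY) n hn _ ⟨Y', hY', ⟨Iso.refl _⟩⟩
    have h1 : f ≫ δ = 0 := by
      rcases eq_or_ne n 1 with rfl | hn1
      · obtain ⟨ψ, hψ⟩ := (shiftFunctor T (1 : ℤ)).map_surjective (f ≫ δ)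
        have h2 : ψ ≫ φ = 0 := by
          apply (shiftFunctor T (1 : ℤ)).map_injective
          rw [Functor.map_comp, hψ, Category.assoc]
          have : δ ≫ φ⟦(1 : ℤ)⟧' = 0 := comp_distTriang_mor_zero₃₁ _ hT
          rw [this]; simp
        have h3 : ψ = 0 := by
          by_contra h3
          exact hφ (filt_comp_ne hS (h Y' hY') hX (h Y hY) ψ h3 φ h2)
        rw [← hψ, h3]; simp
      · exact filt_neg' hS (h Y' hY') (filt.of hX) (by omega) _
    obtain ⟨g, hg⟩ := Triangle.coyoneda_exact₃ _ hT f h1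
    change f = (show Y'⟦n⟧ ⟶ Y from g) ≫ q at hg
    rw [hg, hY0 (show Y'⟦n⟧ ⟶ Y from g), zero_comp]
  have hU : Uc L C := by
    rintro n hn D hD
    intro f
    have h1 : q ≫ f = 0 := by
      rcases hn.lt_or_eq with hn | rfl
      · exact (Cell.of_mem hY).hz hL hn hD _
      · rcases (Cell.of_mem hY).zero_or_iso hL hD (q ≫ f) with h0 | h0
        · exact h0
        · have : φ ≫ q = 0 := comp_distTriang_mor_zero₁₂ _ hT
          exact absurd ((cancel_mono (q ≫ f)).1 (by rw [reassoc_of% this, zero_comp, zero_comp])) hφ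
    obtain ⟨g, hg⟩ := Triangle.yoneda_exact₃ _ hT f h1
    obtain ⟨Y', hY', ⟨e⟩⟩ := hD
    have : g = 0 := (filt_neg' hS (filt.of hX) (h Y' hY') (m := 1) (n := n) (by omega)).of_iso
      (Iso.refl _) e g
    rw [hg, this]
    exact comp_zero
  exact (Triangle.isZero₃_iff_isIso₁ _ hT).1 (isZero_of_uc_vc hL hU hV)

end Helpers

/-- if `S` and `L` are simple-minded collections of `T` and every object of `L`
lies in the extension closure of `S`, then `S = L` up to isomorphism. -/
theorem stmt0 (S L : Set T) (hS : IsSMC S) (hL : IsSMC L)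
    (h : ∀ X ∈ L, filt S X) : isoEq S L := by
  constructor
  · intro X hX
    by_contra hcon
    have hall : ∀ Y ∈ L, ∀ φ : X ⟶ Y, φ = 0 := by
      intro Y hY φ
      by_contra hφ
      have := isIso_of_ne_zero hS hL h hX hY φ hφ
      exact hcon ⟨Y, hY, ⟨asIso φ⟩⟩
    refine hS.nonzero X hX (isZero_of_uc_vc hL ?_ (filt_vc hS h (filt.of hX)))
    rintro n hn C ⟨Y, hY, ⟨e⟩⟩
    rcases hn.lt_or_eq with hn | rfl
    · exact (filt_neg hS (filt.of hX) (h Y hY) hn).of_iso (Iso.refl _) e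
    · have : Hz X Y := hall Y hY
      exact this.of_iso (Iso.refl _) (e ≪≫ (shiftFunctorZero T ℤ).app Y)
  · intro Y hY
    by_contra hcon
    have hall : ∀ X ∈ S, Hz X Y := by
      intro X hX φ
      by_contra hφ
      have := isIso_of_ne_zero hS hL h hX hY φ hφ
      exact hcon ⟨X, hX, ⟨asIso φ⟩⟩
    have hz : ∀ A, filt S A → Hz A Y := by
      intro A hA
      induction hA with
      | of hX => exact hall _ hX
      | zero h => exact Hz.of_zero_left h
      | ext f g h hT hA hB ihA ihB => exact Hz.ext_left _ hT ihA ihB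
    exact hL.nonzero Y hY ((IsZero.iff_id_eq_zero Y).2 (hz Y (h Y hY) _))

end STPaper
end

section
/- If a triangulated category T has a silting object, then every silting subcategory of T has an additive generator, i.e., is of the form add N for some object N. -/
open CategoryTheory Limits Pretriangulated

namespace STPaper

variable {T : Type*} [Category T] [Preadditive T] [HasZeroObject T]
  [HasShift T ℤ] [∀ n : ℤ, (CategoryTheory.shiftFunctor T n).Additive] [Pretriangulated T]

section Silting

variable (T) in
/-- A Krull–Schmidt category: every object is a finite biproduct of objects with local
endomorphism rings. -/
def IsKrullSchmidt [HasFiniteBiproducts T] : Prop :=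
  ∀ X : T, ∃ (n : ℕ) (f : Fin n → T),
    (∀ i, IsLocalRing (End (f i))) ∧ Nonempty (X ≅ ⨁ f)

/-- `X` belongs to `add M`: it is a direct summand of a finite direct sum of copies of `M`. -/
def addObj [HasFiniteBiproducts T] (M : T) (X : T) : Prop :=
  ∃ (n : ℕ) (i : X ⟶ ⨁ (fun _ : Fin n => M)) (r : (⨁ (fun _ : Fin n => M)) ⟶ X),
    i ≫ r = 𝟙 X

/-- The subcategory `add M`. -/
def addSet [HasFiniteBiproducts T] (M : T) : Set T := {X | addObj M X}

/-- A silting object of `T`. -/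
def IsSiltingObj (M : T) : Prop :=
  (∀ n : ℤ, 0 < n → ∀ f : M ⟶ M⟦n⟧, f = 0) ∧ ∀ X : T, thick {M} X

/-- A basic object: it has no repeated (nonzero) direct summand. -/
def IsBasic [HasBinaryBiproducts T] (M : T) : Prop :=
  ¬ ∃ (X Y : T), ¬ IsZero X ∧ Nonempty (M ≅ (X ⊞ X) ⊞ Y)

/-- A silting subcategory of `T`. -/
structure IsSiltingSubcat [HasBinaryBiproducts T] (M : Set T) : Prop where
  isoClosed : ∀ {X Y : T}, (X ≅ Y) → X ∈ M → Y ∈ M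
  zeroMem : ∀ X : T, IsZero X → X ∈ M
  sumMem : ∀ X ∈ M, ∀ Y ∈ M, (X ⊞ Y) ∈ M
  smdMem : ∀ (X Y : T) (i : X ⟶ Y) (r : Y ⟶ X), i ≫ r = 𝟙 X → Y ∈ M → X ∈ M
  presilting : ∀ X ∈ M, ∀ Y ∈ M, ∀ n : ℤ, 0 < n → ∀ f : X ⟶ Y⟦n⟧, f = 0
  generates : ∀ X : T, thick M X

/-- `T_{ℳ,≤0} = {X | Hom(ℳ, Σ^{>0} X) = 0}`. -/
def leM (M : Set T) : Set T :=
  {X | ∀ n : ℤ, 0 < n → ∀ Y ∈ M, ∀ f : Y ⟶ X⟦n⟧, f = 0}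

/-- `Σ^l ℳ ∗ Σ^{l-1} ℳ ∗ ⋯ ∗ ℳ`. -/
def geChainM (M : Set T) : ℕ → Set T
  | 0 => M
  | (l+1) => star (shSet M (l+1 : ℤ)) (geChainM M l)

/-- `T_{ℳ,≥0} = ⋃_{l ≥ 0} Σ^l ℳ ∗ ⋯ ∗ ℳ`. -/
def geM (M : Set T) : Set T := ⋃ l, geChainM M l

/-- `ℳ ∗ Σℳ ∗ ⋯ ∗ Σ^l ℳ`. -/
def leChainM (M : Set T) : ℕ → Set T
  | 0 => M
  | (l+1) => star (leChainM M l) (shSet M (l+1 : ℤ))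

/-- A co-`t`-structure `(Ge, Le) = (T_{≥0}, T_{≤0})` on `T`. -/
structure IsCotStr [HasBinaryBiproducts T] (Ge Le : Set T) : Prop where
  isoGe : ∀ {X Y : T}, (X ≅ Y) → X ∈ Ge → Y ∈ Ge
  zeroGe : ∀ X : T, IsZero X → X ∈ Ge
  sumGe : ∀ X ∈ Ge, ∀ Y ∈ Ge, (X ⊞ Y) ∈ Ge
  smdGe : ∀ (X Y : T) (i : X ⟶ Y) (r : Y ⟶ X), i ≫ r = 𝟙 X → Y ∈ Ge → X ∈ Ge
  isoLe : ∀ {X Y : T}, (X ≅ Y) → X ∈ Le → Y ∈ Le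
  zeroLe : ∀ X : T, IsZero X → X ∈ Le
  sumLe : ∀ X ∈ Le, ∀ Y ∈ Le, (X ⊞ Y) ∈ Le
  smdLe : ∀ (X Y : T) (i : X ⟶ Y) (r : Y ⟶ X), i ≫ r = 𝟙 X → Y ∈ Le → X ∈ Le
  ge_shift : ∀ X ∈ Ge, X⟦(-1:ℤ)⟧ ∈ Ge
  le_shift : ∀ X ∈ Le, X⟦(1:ℤ)⟧ ∈ Le
  hom_zero : ∀ X ∈ Ge, ∀ Y ∈ Le, ∀ f : X⟦(-1:ℤ)⟧ ⟶ Y, f = 0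
  exhaust : ∀ Z : T, Z ∈ star (shSet Ge (-1)) Le

/-- A bounded co-`t`-structure. -/
structure IsBoundedCot [HasBinaryBiproducts T] (Ge Le : Set T) : Prop where
  toCot : IsCotStr Ge Le
  bddGe : ∀ X : T, ∃ n : ℤ, X⟦n⟧ ∈ Ge
  bddLe : ∀ X : T, ∃ n : ℤ, X⟦n⟧ ∈ Le

end Silting

/-- all shifts of `N`, up to isomorphism -/
def SZ (N : T) : Set T := {X | ∃ k : ℤ, Nonempty (X ≅ N⟦k⟧)}

/-- all nonpositive shifts of `N`, up to isomorphism -/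
def SL (N : T) : Set T := {X | ∃ k : ℤ, k ≤ 0 ∧ Nonempty (X ≅ N⟦k⟧)}

/-- left orthogonal of positive shifts -/
def WW (N : T) (W : T) : Prop := ∀ k : ℤ, 0 < k → ∀ φ : W ⟶ N⟦k⟧, φ = 0

open scoped ZeroObject

theorem yex2 {A Z B X : T} {f : A ⟶ Z} {g : Z ⟶ B} {h : B ⟶ A⟦(1:ℤ)⟧}
    (hT : Triangle.mk f g h ∈ distTriang T) (φ : Z ⟶ X) (hφ : f ≫ φ = 0) :
    ∃ ψ : B ⟶ X, φ = g ≫ ψ := Triangle.yoneda_exact₂ _ hT φ hφ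

theorem cyex1 {A Z B X : T} {f : A ⟶ Z} {g : Z ⟶ B} {h : B ⟶ A⟦(1:ℤ)⟧}
    (hT : Triangle.mk f g h ∈ distTriang T) (φ : X ⟶ A⟦(1:ℤ)⟧) (hφ : φ ≫ f⟦(1:ℤ)⟧' = 0) :
    ∃ ψ : X ⟶ B, φ = ψ ≫ h := Triangle.coyoneda_exact₁ _ hT φ hφ

theorem cyex2 {A Z B X : T} {f : A ⟶ Z} {g : Z ⟶ B} {h : B ⟶ A⟦(1:ℤ)⟧}
    (hT : Triangle.mk f g h ∈ distTriang T) (φ : X ⟶ Z) (hφ : φ ≫ g = 0) :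
    ∃ ψ : X ⟶ A, φ = ψ ≫ f := Triangle.coyoneda_exact₂ _ hT φ hφ

theorem cyex3 {A Z B X : T} {f : A ⟶ Z} {g : Z ⟶ B} {h : B ⟶ A⟦(1:ℤ)⟧}
    (hT : Triangle.mk f g h ∈ distTriang T) (φ : X ⟶ B) (hφ : φ ≫ h = 0) :
    ∃ ψ : X ⟶ Z, φ = ψ ≫ g := Triangle.coyoneda_exact₃ _ hT φ hφ

theorem rot_mk {A Z B : T} {f : A ⟶ Z} {g : Z ⟶ B} {h : B ⟶ A⟦(1:ℤ)⟧}
    (hT : Triangle.mk f g h ∈ distTriang T) :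
    Triangle.mk g h (-f⟦(1:ℤ)⟧') ∈ distTriang T := rot_of_distTriang _ hT

theorem complete2 {A Z B A' Z' B' : T} {f : A ⟶ Z} {g : Z ⟶ B} {h : B ⟶ A⟦(1:ℤ)⟧}
    {f' : A' ⟶ Z'} {g' : Z' ⟶ B'} {h' : B' ⟶ A'⟦(1:ℤ)⟧}
    (hT : Triangle.mk f g h ∈ distTriang T) (hT' : Triangle.mk f' g' h' ∈ distTriang T)
    (a : A ⟶ A') (c : B ⟶ B') (comm : h ≫ a⟦(1:ℤ)⟧' = c ≫ h') :
    ∃ b : Z ⟶ Z', f ≫ b = a ≫ f' ∧ g ≫ c = b ≫ g' :=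
  complete_distinguished_triangle_morphism₂ _ _ hT hT' a c comm

theorem iso2 {A Z B : T} {f : A ⟶ Z} {g : Z ⟶ B} {h : B ⟶ A⟦(1:ℤ)⟧}
    (hT : Triangle.mk f g h ∈ distTriang T) (w : Z ⟶ Z) (h1 : f ≫ w = f) (h2 : w ≫ g = g) :
    IsIso w :=
  isIso₂_of_isIso₁₃ (T := Triangle.mk f g h) (T' := Triangle.mk f g h)
    { hom₁ := 𝟙 A
      hom₂ := w
      hom₃ := 𝟙 B
      comm₁ := h1.trans (Category.id_comp f).symm
      comm₂ := (Category.comp_id g).trans h2.symm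
      comm₃ := show h ≫ (𝟙 A)⟦(1:ℤ)⟧' = 𝟙 B ≫ h by
        rw [CategoryTheory.Functor.map_id, Category.comp_id, Category.id_comp] } hT hT (IsIso.id A) (IsIso.id B)

theorem hom_shift_zero (X Y : T) (m k : ℤ) (h : ∀ f : X ⟶ Y⟦k - m⟧, f = 0)
    (φ : X⟦m⟧ ⟶ Y⟦k⟧) : φ = 0 := by
  apply (shiftFunctor T (-m)).map_injective
  rw [Functor.map_zero]
  have e := (shiftFunctorCompIsoId T m (-m) (by omega)).app X
  have e' := (shiftFunctorAdd' T k (-m) (k - m) (by omega)).app Y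
  have h1 := h (e.inv ≫ φ⟦-m⟧' ≫ e'.inv)
  have h2 : φ⟦-m⟧' = e.hom ≫ (e.inv ≫ φ⟦-m⟧' ≫ e'.inv) ≫ e'.hom := by simp
  rw [h2, h1, zero_comp, comp_zero]

theorem thick_trans {S S' : Set T} (h : ∀ X ∈ S, thick S' X) {X : T} (hX : thick S X) :
    thick S' X := by
  induction hX with
  | of hm => exact h _ hm
  | zero hz => exact thick.zero hz
  | shift _ n ih => exact thick.shift ih n
  | ext f g k hT _ _ ihA ihB => exact thick.ext f g k hT ihA ihB
  | smd i r hir _ ih => exact thick.smd i r hir ih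

theorem exists_gen [HasBinaryBiproducts T] {M : Set T} (hM : IsSiltingSubcat M) {X : T}
    (hX : thick M X) : ∃ N ∈ M, thick {N} X := by
  induction hX with
  | @of X hm => exact ⟨X, hm, thick.of rfl⟩
  | zero hz => exact ⟨0, hM.zeroMem _ (isZero_zero T), thick.zero hz⟩
  | shift _ n ih =>
    obtain ⟨N, hN, h⟩ := ih
    exact ⟨N, hN, thick.shift h n⟩
  | ext f g k hT _ _ ihA ihB =>
    obtain ⟨N₁, hN₁, h₁⟩ := ihA
    obtain ⟨N₂, hN₂, h₂⟩ := ihB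
    refine ⟨N₁ ⊞ N₂, hM.sumMem _ hN₁ _ hN₂, thick.ext f g k hT (thick_trans ?_ h₁)
      (thick_trans ?_ h₂)⟩
    · rintro X rfl
      exact thick.smd biprod.inl biprod.fst (by simp) (thick.of rfl)
    · rintro X rfl
      exact thick.smd biprod.inr biprod.snd (by simp) (thick.of rfl)
  | smd i r hir _ ih =>
    obtain ⟨N, hN, h⟩ := ih
    exact ⟨N, hN, thick.smd i r hir h⟩

theorem filt_shift (N : T) {Y : T} (hY : filt (SZ N) Y) (n : ℤ) : filt (SZ N) (Y⟦n⟧) := by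
  induction hY with
  | of hm =>
    obtain ⟨k, ⟨e⟩⟩ := hm
    exact filt.of ⟨k + n, ⟨(shiftFunctor T n).mapIso e ≪≫
      ((shiftFunctorAdd' T k n (k + n) rfl).app N).symm⟩⟩
  | zero hz => exact filt.zero ((shiftFunctor T n).map_isZero hz)
  | ext f g k hT _ _ ihA ihB =>
    exact filt.ext _ _ _ (Triangle.shift_distinguished _ hT n) ihA ihB

theorem thick_retract (N : T) {X : T} (hX : thick {N} X) :
    ∃ (Y : T) (i : X ⟶ Y) (r : Y ⟶ X), i ≫ r = 𝟙 X ∧ filt (SZ N) Y := by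
  induction hX with
  | @of X hm =>
    obtain rfl : X = N := hm
    exact ⟨X, 𝟙 _, 𝟙 _, by simp, filt.of ⟨0, ⟨((shiftFunctorZero T ℤ).app X).symm⟩⟩⟩
  | @zero X hz => exact ⟨X, 𝟙 _, 𝟙 _, by simp, filt.zero hz⟩
  | shift _ n ih =>
    obtain ⟨Y, i, r, h, hY⟩ := ih
    exact ⟨Y⟦n⟧, i⟦n⟧', r⟦n⟧', by rw [← Functor.map_comp, h, CategoryTheory.Functor.map_id], filt_shift N hY n⟩
  | smd i r hir _ ih =>
    obtain ⟨Y, i', r', h, hY⟩ := ih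
    exact ⟨Y, i ≫ i', r' ≫ r, by simp [reassoc_of% h, hir], hY⟩
  | @ext A Z B f g k hT _ _ ihA ihB =>
    obtain ⟨YA, iA, rA, hA, hYA⟩ := ihA
    obtain ⟨YB, iB, rB, hB, hYB⟩ := ihB
    obtain ⟨E, f', g', hE⟩ := distinguished_cocone_triangle₂ (rB ≫ k ≫ iA⟦(1:ℤ)⟧')
    obtain ⟨u, hu1, hu2⟩ := complete2 hT hE iA iB
      (by simp [reassoc_of% hB])
    obtain ⟨v, hv1, hv2⟩ := complete2 hE hT rA rB
      (by simp [← Functor.map_comp, hA])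
    have hi : IsIso (u ≫ v) := iso2 hT _
      (by rw [reassoc_of% hu1, hv1, reassoc_of% hA])
      (by rw [Category.assoc, ← hv2, ← reassoc_of% hu2, hB, Category.comp_id])
    exact ⟨E, u, v ≫ inv (u ≫ v), by rw [← Category.assoc, IsIso.hom_inv_id],
      filt.ext _ _ _ hE hYA hYB⟩

theorem WW_shift {N W : T} (h : WW N W) : WW N (W⟦(-1:ℤ)⟧) := fun k hk φ =>
  hom_shift_zero _ _ _ _ (h (k - -1) (by omega)) φ

theorem WW_filt {N : T} (hN : ∀ n : ℤ, 0 < n → ∀ f : N ⟶ N⟦n⟧, f = 0) {A : T}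
    (hA : filt (SL N) A) : WW N A := by
  induction hA with
  | of hm =>
    obtain ⟨m, hm, ⟨e⟩⟩ := hm
    intro k hk φ
    have := hom_shift_zero _ _ _ _ (hN (k - m) (by omega)) (e.inv ≫ φ)
    rw [← cancel_epi e.inv, this, comp_zero]
  | zero hz => exact fun k hk φ => hz.eq_of_src _ _
  | ext f g h hT _ _ ihA ihB =>
    intro k hk φ
    obtain ⟨ψ, hψ⟩ := yex2 hT φ (ihA k hk _)
    rw [hψ, ihB k hk ψ, comp_zero]

theorem lift_shift {N A Z : T} (f : A ⟶ Z)
    (hs : ∀ W, WW N W → ∀ φ : W ⟶ Z, ∃ ψ : W ⟶ A, ψ ≫ f = φ)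
    {W : T} (hW : WW N W) (φ : W ⟶ Z⟦(1:ℤ)⟧) : ∃ ψ : W ⟶ A⟦(1:ℤ)⟧, ψ ≫ f⟦(1:ℤ)⟧' = φ := by
  let e := shiftFunctorCompIsoId T (1:ℤ) (-1) (by omega)
  obtain ⟨ψ, hψ⟩ := hs _ (WW_shift hW) (φ⟦(-1:ℤ)⟧' ≫ e.hom.app Z)
  refine ⟨(shiftFunctor T (-1:ℤ)).preimage (ψ ≫ e.inv.app A), ?_⟩
  apply (shiftFunctor T (-1:ℤ)).map_injective
  rw [Functor.map_comp, Functor.map_preimage, Category.assoc]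
  have := e.inv.naturality f
  dsimp at this
  rw [← this, ← Category.assoc, hψ]
  simp

theorem approx {N : T} (hN : ∀ n : ℤ, 0 < n → ∀ f : N ⟶ N⟦n⟧, f = 0) {Z : T}
    (hZ : filt (SZ N) Z) : ∃ (A : T) (f : A ⟶ Z), filt (SL N) A ∧
      (∀ W, WW N W → ∀ φ : W ⟶ Z, ∃ ψ : W ⟶ A, ψ ≫ f = φ) ∧
      (∀ W, WW N W → ∀ ψ : W ⟶ A⟦(1:ℤ)⟧, ψ ≫ f⟦(1:ℤ)⟧' = 0 → ψ = 0) := by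
  induction hZ with
  | @of Z hm =>
    obtain ⟨k, ⟨e⟩⟩ := hm
    by_cases hk : k ≤ 0
    · exact ⟨Z, 𝟙 _, filt.of ⟨k, hk, ⟨e⟩⟩, fun W _ φ => ⟨φ, by simp⟩, fun W _ ψ h => by simpa using h⟩
    · refine ⟨0, 0, filt.zero (isZero_zero T), fun W hW φ => ⟨0, ?_⟩, fun W _ ψ _ => ?_⟩
      · rw [← cancel_mono e.hom, hW k (by omega) (φ ≫ e.hom)]
        simp
      · exact ((shiftFunctor T (1:ℤ)).map_isZero (isZero_zero T)).eq_of_tgt _ _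
  | @zero Z hz =>
    exact ⟨Z, 𝟙 _, filt.zero hz, fun W _ φ => ⟨φ, by simp⟩, fun W _ ψ h => by simpa using h⟩
  | @ext Z₁ Z Z₂ f g h hT _ _ ih₁ ih₂ =>
    obtain ⟨A₁, a₁, hA₁, s₁, j₁⟩ := ih₁
    obtain ⟨A₂, a₂, hA₂, s₂, j₂⟩ := ih₂
    obtain ⟨h', hh'⟩ := lift_shift a₁ s₁ (WW_filt hN hA₂) (a₂ ≫ h)
    obtain ⟨A, f', g', hA⟩ := distinguished_cocone_triangle₂ h'
    obtain ⟨a, ha1, ha2⟩ := complete2 hA hT a₁ a₂ hh'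
    have gh : g ≫ h = 0 := comp_distTriang_mor_zero₂₃ _ hT
    have hf' : h' ≫ f'⟦(1:ℤ)⟧' = 0 := comp_distTriang_mor_zero₃₁ _ hA
    refine ⟨A, a, filt.ext _ _ _ hA hA₁ hA₂, fun W hW φ => ?_, fun W hW ψ hψ => ?_⟩
    · obtain ⟨β, hβ⟩ := s₂ W hW (φ ≫ g)
      have h0 : β ≫ h' = 0 := j₁ W hW _ (by
        rw [Category.assoc, hh', reassoc_of% hβ, gh, comp_zero])
      obtain ⟨α, hα⟩ := cyex3 hA β h0
      obtain ⟨γ, hγ⟩ := cyex2 hT (φ - α ≫ a) (by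
        rw [Preadditive.sub_comp, Category.assoc, ← ha2, ← reassoc_of% hα, hβ, sub_self])
      obtain ⟨δ, hδ⟩ := s₁ W hW γ
      refine ⟨α + δ ≫ f', ?_⟩
      rw [Preadditive.add_comp, Category.assoc, ha1, reassoc_of% hδ, ← hγ]
      abel
    · have h0 : ψ ≫ g'⟦(1:ℤ)⟧' = 0 := j₂ W hW _ (by
        rw [Category.assoc, ← Functor.map_comp, ha2, Functor.map_comp, reassoc_of% hψ, zero_comp])
      obtain ⟨χ, hχ⟩ := cyex1 (rot_mk hA) ψ h0
      obtain ⟨γ, hγ⟩ := cyex1 hT (χ ≫ a₁⟦(1:ℤ)⟧') (by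
        rw [Category.assoc, ← Functor.map_comp, ← ha1, Functor.map_comp]
        rw [hχ] at hψ
        simpa using hψ)
      obtain ⟨β, hβ⟩ := s₂ W hW γ
      have h1 : χ - β ≫ h' = 0 := j₁ W hW _ (by
        rw [Preadditive.sub_comp, Category.assoc, hh', hγ, reassoc_of% hβ, sub_self])
      rw [hχ, sub_eq_zero.1 h1, Preadditive.comp_neg, Category.assoc, hf', comp_zero, neg_zero]

theorem coapprox {N : T} (hN : ∀ n : ℤ, 0 < n → ∀ f : N ⟶ N⟦n⟧, f = 0) {A : T}
    (hA : filt (SL N) A) : ∃ (n : ℕ) (u : Fin n → (A ⟶ N)),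
      ∀ Y : T, (∀ k : ℤ, k < 0 → ∀ φ : N⟦k⟧ ⟶ Y, φ = 0) → ∀ g : A ⟶ Y,
        ∃ v : Fin n → (N ⟶ Y), g = ∑ j, u j ≫ v j := by
  induction hA with
  | @of A hm =>
    obtain ⟨k, hk, ⟨e⟩⟩ := hm
    rcases hk.lt_or_eq with hk | rfl
    · refine ⟨0, Fin.elim0, fun Y hY g => ⟨Fin.elim0, ?_⟩⟩
      rw [← cancel_epi e.inv, hY k hk (e.inv ≫ g)]
      simp
    · let e' : A ≅ N := e ≪≫ (shiftFunctorZero T ℤ).app N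
      exact ⟨1, fun _ => e'.hom, fun Y hY g => ⟨fun _ => e'.inv ≫ g, by simp⟩⟩
  | zero hz => exact ⟨0, Fin.elim0, fun Y hY g => ⟨Fin.elim0, hz.eq_of_src _ _⟩⟩
  | @ext A₁ A A₂ f g h hT hA₁ hA₂ ih₁ ih₂ =>
    obtain ⟨n₁, u₁, h₁⟩ := ih₁
    obtain ⟨n₂, u₂, h₂⟩ := ih₂
    have hext : ∀ w : A₁ ⟶ N, ∃ w' : A ⟶ N, f ≫ w' = w := by
      intro w
      obtain ⟨ψ, hψ⟩ := yex2 (rot_mk (rot_mk hT)) (w⟦(1:ℤ)⟧')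
        (WW_filt hN hA₂ 1 (by omega) _)
      refine ⟨(shiftFunctor T (1:ℤ)).preimage (-ψ), ?_⟩
      apply (shiftFunctor T (1:ℤ)).map_injective
      rw [Functor.map_comp, Functor.map_preimage, hψ]
      simp
    choose E hE using hext
    refine ⟨n₁ + n₂, Fin.append (fun j => E (u₁ j)) (fun j => g ≫ u₂ j), fun Y hY φ => ?_⟩
    obtain ⟨v₁, hv₁⟩ := h₁ Y hY (f ≫ φ)
    obtain ⟨ψ, hψ⟩ := yex2 hT (φ - ∑ j, E (u₁ j) ≫ v₁ j) (by
      rw [Preadditive.comp_sub, Preadditive.comp_sum, hv₁, sub_eq_zero]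
      exact Finset.sum_congr rfl fun j _ => by rw [reassoc_of% hE])
    obtain ⟨v₂, hv₂⟩ := h₂ Y hY ψ
    refine ⟨Fin.append v₁ v₂, ?_⟩
    rw [Fin.sum_univ_add]
    simp only [Fin.append_left, Fin.append_right, Category.assoc]
    rw [← Preadditive.comp_sum, ← hv₂, ← hψ]
    abel

theorem sum_factors [HasBinaryBiproducts T] {M : Set T} (hM : IsSiltingSubcat M) {N : T}
    (hN : N ∈ M) (X Y : T) (n : ℕ) (u : Fin n → (X ⟶ N)) (v : Fin n → (N ⟶ Y)) :
    ∃ (Q : T) (i : X ⟶ Q) (r : Q ⟶ Y), Q ∈ M ∧ i ≫ r = ∑ j, u j ≫ v j := by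
  induction n with
  | zero => exact ⟨0, 0, 0, hM.zeroMem _ (isZero_zero T), by simp⟩
  | succ n ih =>
    obtain ⟨Q, i, r, hQ, h⟩ := ih (fun j => u j.succ) (fun j => v j.succ)
    refine ⟨N ⊞ Q, biprod.lift (u 0) i, biprod.desc (v 0) r, hM.sumMem _ hN _ hQ, ?_⟩
    rw [Fin.sum_univ_succ, biprod.lift_desc, h]

/-- if `T` has a silting object, then every silting subcategory of `T` has an
additive generator. -/
theorem stmt5 [HasFiniteBiproducts T] (hex : ∃ M₀ : T, IsSiltingObj M₀)
    (M : Set T) (hM : IsSiltingSubcat M) :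
    ∃ N : T, M = addSet N := by
  obtain ⟨M₀, -, hgen⟩ := hex
  obtain ⟨N, hNM, hN⟩ := exists_gen hM (hM.generates M₀)
  have hall : ∀ X : T, thick {N} X := fun X =>
    thick_trans (by rintro Y rfl; exact hN) (hgen X)
  have hpre := hM.presilting N hNM N hNM
  refine ⟨N, Set.ext fun X => ⟨fun hX => ?_, ?_⟩⟩
  · obtain ⟨Y, i, r, hir, hY⟩ := thick_retract N (hall X)
    obtain ⟨A, a, hA, s, -⟩ := approx hpre hY
    obtain ⟨ι, hι⟩ := s X (hM.presilting X hX N hNM) i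
    obtain ⟨n, u, hu⟩ := coapprox hpre hA
    obtain ⟨v, hv⟩ := hu X (fun k hk φ => by
      let e := (shiftFunctorZero T ℤ).app X
      have := hom_shift_zero N X k 0 (hM.presilting N hNM X hX _ (by omega)) (φ ≫ e.inv)
      rw [← cancel_mono e.inv, this, zero_comp]) (a ≫ r)
    refine ⟨n, biproduct.lift fun j => ι ≫ u j, biproduct.desc v, ?_⟩
    rw [biproduct.lift_desc]
    simp only [Category.assoc]
    rw [← Preadditive.comp_sum, ← hv, reassoc_of% hι, hir]
  · rintro ⟨n, i, r, hir⟩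
    obtain ⟨Q, i', r', hQ, h⟩ := sum_factors hM hNM X X n
      (fun j => i ≫ biproduct.π (fun _ : Fin n => N) j) (fun j => biproduct.ι (fun _ : Fin n => N) j ≫ r)
    refine hM.smdMem X Q i' r' ?_ hQ
    rw [h, ← hir]
    have := biproduct.total (f := fun _ : Fin n => N)
    calc _ = i ≫ (∑ j, biproduct.π (fun _ : Fin n => N) j ≫ biproduct.ι (fun _ : Fin n => N) j) ≫ r := by
          simp only [Preadditive.comp_sum, Preadditive.sum_comp, Category.assoc]
      _ = _ := by rw [this, Category.id_comp]

end STPaper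
end
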